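/- Let X be an ℝ^d-valued random vector and ‖·‖ a norm on ℝ^d. If E[ log(1 + ‖X‖) ] < ∞, then H(⌊X⌋) < ∞. -/

import Mathlib

open MeasureTheory ProbabilityTheory Real Filter Topology
open scoped ENNReal

/-- Componentwise integer part of a vector in ℝ^d. -/
noncomputable def intFloor (d : ℕ) (x : Fin d → ℝ) : Fin d → ℤ := fun i => ⌊x i⌋

/-- Discrete (Shannon) entropy, in nats, of the random element `V` under `P`,
valued in `[0,∞]`. -/
noncomputable def discEnt {Ω α : Type*} [MeasurableSpace Ω] (P : Measure Ω) (V : Ω → α) : ℝ≥0∞ :=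
  ∑' a : α, ENNReal.ofReal (Real.negMulLog (P (V ⁻¹' {a})).toReal)

/-- Differential entropy of a measure on ℝ^d (w.r.t. Lebesgue measure),
as a Bochner integral of `-f log f` where `f` is the Radon–Nikodym density. -/
noncomputable def diffEnt {d : ℕ} (μ : Measure (Fin d → ℝ)) : ℝ :=
  -∫ x, ((μ.rnDeriv volume x).toReal) * Real.log ((μ.rnDeriv volume x).toReal)

open Classical in
/-- Kullback–Leibler divergence of `μ` w.r.t. `ν`, valued in `[0,∞]`. -/
noncomputable def klDiv {α : Type*} [MeasurableSpace α] (μ ν : Measure α) : ℝ≥0∞ :=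
  if μ ≪ ν ∧ Integrable (llr μ ν) μ then ENNReal.ofReal (∫ x, llr μ ν x ∂μ) else ⊤

/-- Tonelli for products of a function over the coordinates of a tuple. -/
theorem tsum_fin_prod_eq_pow {ι : Type*} (f : ι → ℝ≥0∞) (n : ℕ) :
    ∑' a : Fin n → ι, ∏ i, f (a i) = (∑' x, f x) ^ n := by
  induction n with
  | zero => simp
  | succ n ih =>
    rw [← (Fin.consEquiv fun _ => ι).tsum_eq, ENNReal.tsum_prod']
    simp only [Fin.consEquiv, Equiv.coe_fn_mk, Fin.prod_univ_succ, Fin.cons_zero, Fin.cons_succ,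
      ENNReal.tsum_mul_left, ih, ENNReal.tsum_mul_right, pow_succ']

/-- Gibbs' inequality in pointwise form. -/
theorem negMulLog_le_mul_neg_log_add {p q : ℝ} (hp : 0 ≤ p) (hq : 0 < q) :
    Real.negMulLog p ≤ p * -Real.log q + q := by
  rcases hp.eq_or_lt with rfl | hp
  · simpa using hq.le
  have h := mul_le_mul_of_nonneg_left (Real.log_le_sub_one_of_pos (div_pos hq hp)) hp.le
  rw [Real.log_div hq.ne' hp.ne', mul_sub, mul_sub, mul_div_cancel₀ _ hp.ne'] at h
  rw [Real.negMulLog]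
  linarith

/-- Entropy is bounded by cross-entropy plus the mass of the reference weights. -/
theorem discEnt_le_lintegral_add_tsum {Ω α : Type*} [MeasurableSpace Ω] [MeasurableSpace α]
    [Countable α] [MeasurableSingletonClass α] (P : Measure Ω) [IsFiniteMeasure P]
    {V : Ω → α} (hV : Measurable V) {q : α → ℝ} (hq : ∀ a, 0 < q a) :
    discEnt P V ≤
      ∫⁻ ω, ENNReal.ofReal (-Real.log (q (V ω))) ∂P + ∑' a, ENNReal.ofReal (q a) := by
  rw [← lintegral_map (f := fun a => ENNReal.ofReal (-Real.log (q a)))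
    (measurable_of_countable _) hV, lintegral_countable', ← ENNReal.tsum_add]
  refine ENNReal.tsum_le_tsum fun a => ?_
  rw [Measure.map_apply hV (measurableSet_singleton a)]
  refine (ENNReal.ofReal_le_ofReal
    (negMulLog_le_mul_neg_log_add ENNReal.toReal_nonneg (hq a))).trans ?_
  refine ENNReal.ofReal_add_le.trans ?_
  rw [ENNReal.ofReal_mul ENNReal.toReal_nonneg, ENNReal.ofReal_toReal (measure_ne_top _ _),
    mul_comm]

theorem summable_int_inv_one_add_abs_sq :
    Summable fun n : ℤ => ((1 + |(n : ℝ)|) ^ 2)⁻¹ := by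
  have h : Summable fun n : ℕ => ((1 + (n : ℝ)) ^ 2)⁻¹ := by
    have := (summable_nat_add_iff 1).2 (Real.summable_nat_pow_inv.2 one_lt_two)
    simpa [add_comm] using this
  exact Summable.of_nat_of_neg (by simpa using h) (by simpa using h)

/-- A continuous definite seminorm on `ℝ^d` dominates the sup norm. -/
theorem exists_norm_le_mul_seminorm {d : ℕ} (ν : Seminorm ℝ (Fin d → ℝ))
    (hνdef : ∀ x, ν x = 0 → x = 0) (hνcont : Continuous fun x => ν x) :
    ∃ C : ℝ, 0 ≤ C ∧ ∀ x, ‖x‖ ≤ C * ν x := by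
  rcases (Metric.sphere (0 : Fin d → ℝ) 1).eq_empty_or_nonempty with h | h
  · refine ⟨0, le_rfl, fun x => ?_⟩
    by_contra! hx
    have hx : ‖x‖ ≠ 0 := by linarith
    have : ‖x‖⁻¹ • x ∈ Metric.sphere (0 : Fin d → ℝ) 1 := by
      simp [norm_smul, inv_mul_cancel₀ hx]
    simp [h] at this
  · obtain ⟨y, hy, hmin⟩ := (isCompact_sphere (0 : Fin d → ℝ) 1).exists_isMinOn h
      hνcont.continuousOn
    have hy0 : ν y ≠ 0 := fun h0 => by simp [hνdef y h0] at hy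
    have hpos : 0 < ν y := lt_of_le_of_ne (apply_nonneg ν y) hy0.symm
    refine ⟨(ν y)⁻¹, by positivity, fun x => ?_⟩
    rcases eq_or_ne x 0 with rfl | hx
    · simp
    have hx : 0 < ‖x‖ := norm_pos_iff.2 hx
    have hm : ν y ≤ ν (‖x‖⁻¹ • x) := hmin (by simp [norm_smul, inv_mul_cancel₀ hx.ne'])
    rw [map_smul_eq_mul, norm_inv, norm_norm, inv_mul_eq_div, le_div_iff₀ hx] at hm
    rwa [inv_mul_eq_div, le_div_iff₀ hpos, mul_comm]

theorem abs_floor_le_abs_add_one (x : ℝ) : |(⌊x⌋ : ℝ)| ≤ |x| + 1 := by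
  have h₁ := Int.floor_le x
  have h₂ := Int.lt_floor_add_one x
  rw [abs_le]
  constructor <;> linarith [neg_abs_le x, le_abs_self x]

theorem measurable_intFloor (d : ℕ) : Measurable (intFloor d) :=
  measurable_pi_lambda _ fun i => Int.measurable_floor.comp (measurable_pi_apply i)

/-- If `E[log(1 + ‖X‖)] < ∞` then `H(⌊X⌋) < ∞`. -/
theorem floorEntropy_lt_top_of_integrable_log
    {Ω : Type*} [MeasurableSpace Ω] (P : Measure Ω) [IsProbabilityMeasure P]
    (d : ℕ)
    (ν : Seminorm ℝ (Fin d → ℝ)) (hνdef : ∀ x, ν x = 0 → x = 0)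
    (hνcont : Continuous fun x => ν x)
    (X : Ω → (Fin d → ℝ)) (hX : Measurable X)
    (hmom : Integrable (fun ω => Real.log (1 + ν (X ω))) P) :
    discEnt P (fun ω => intFloor d (X ω)) ≠ ⊤ := by
  obtain ⟨C, hC, hCν⟩ := exists_norm_le_mul_seminorm ν hνdef hνcont
  let q : (Fin d → ℤ) → ℝ := fun a => ∏ i, ((1 + |(a i : ℝ)|) ^ 2)⁻¹
  have hq : ∀ a, 0 < q a := fun a => Finset.prod_pos fun i _ => by positivity
  refine ne_top_of_le_ne_top (ENNReal.add_ne_top.2 ⟨?_, ?_⟩)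
    (discEnt_le_lintegral_add_tsum P ((measurable_intFloor d).comp hX) hq)
  · have hint : Integrable
        (fun ω => d * (2 * (Real.log (2 + C) + Real.log (1 + ν (X ω))))) P :=
      (((integrable_const _).add hmom).const_mul 2).const_mul _
    refine ne_top_of_le_ne_top hint.lintegral_lt_top.ne (lintegral_mono fun ω => ?_)
    refine ENNReal.ofReal_le_ofReal ?_
    have hν : 0 ≤ ν (X ω) := apply_nonneg ν _
    have hlog : -Real.log (q (intFloor d (X ω))) =
        ∑ i, 2 * Real.log (1 + |(⌊X ω i⌋ : ℝ)|) := by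
      rw [Real.log_prod fun i _ => by positivity, ← Finset.sum_neg_distrib]
      simp [intFloor, Real.log_inv, Real.log_pow]
    simp only [Function.comp_apply, hlog]
    refine (Finset.sum_le_card_nsmul _ _
      (2 * (Real.log (2 + C) + Real.log (1 + ν (X ω)))) fun i _ => ?_).trans_eq (by simp)
    rw [← Real.log_mul (by positivity) (by positivity)]
    refine mul_le_mul_of_nonneg_left (Real.log_le_log (by positivity) ?_) zero_le_two
    have hi : |X ω i| ≤ C * ν (X ω) := (norm_le_pi_norm (X ω) i).trans (hCν _)
    nlinarith [abs_floor_le_abs_add_one (X ω i)]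
  · have hprod : ∀ a, ENNReal.ofReal (q a) =
        ∏ i, ENNReal.ofReal ((1 + |(a i : ℝ)|) ^ 2)⁻¹ := fun a =>
      ENNReal.ofReal_prod_of_nonneg fun i _ => by positivity
    simp_rw [hprod]
    rw [tsum_fin_prod_eq_pow fun n : ℤ => ENNReal.ofReal ((1 + |(n : ℝ)|) ^ 2)⁻¹]
    exact ENNReal.pow_ne_top summable_int_inv_one_add_abs_sq.tsum_ofReal_ne_top
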